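/- arXiv:2205.05363 — 3 statements merged into one kernel-verified Lean document; each statement's English description precedes it below -/
import Mathlib

section
/- For every n ≥ 1 there exists a rational number q such that: (a) every instance with n agents having additive nonnegative valuations over a finite set of items admits an allocation A with v^i(A_i) ≥ q·MMS^i for every agent i; and (b) there exists an instance with n agents having additive nonnegative valuations in which every allocation A has some agent i with v^i(A_i) ≤ q·MMS^i. In other words, the optimal MMS approximation ratio ρ_n for n agents with additive nonnegative valuations exists and is rational. -/
/-- The total value of the bundle given to agent `j` by allocation/partition `f`. -/
noncomputable def bundleVal {M : Type*} [Fintype M] {n : ℕ} (v : M → ℝ)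
    (f : M → Fin n) (j : Fin n) : ℝ :=
  ∑ e ∈ Finset.univ.filter (fun e => f e = j), v e

/-- The maximin share: max over partitions into `n` bundles of the min bundle value. -/
noncomputable def MMS {M : Type*} [Fintype M] [DecidableEq M] (n : ℕ) [NeZero n]
    (v : M → ℝ) : ℝ :=
  Finset.univ.sup' Finset.univ_nonempty fun f : M → Fin n =>
    Finset.univ.inf' Finset.univ_nonempty fun j => bundleVal v f j

/-- The minimax share: min over partitions into `n` bundles of the max bundle value. -/
noncomputable def mmS {M : Type*} [Fintype M] [DecidableEq M] (n : ℕ) [NeZero n]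
    (v : M → ℝ) : ℝ :=
  Finset.univ.inf' Finset.univ_nonempty fun f : M → Fin n =>
    Finset.univ.sup' Finset.univ_nonempty fun j => bundleVal v f j

/-- The proportional share: total value divided by the number `n` of agents. -/
noncomputable def PS {M : Type*} [Fintype M] (n : ℕ) (v : M → ℝ) : ℝ :=
  (∑ e, v e) / n

open Filter Topology

section BundleVal

variable {M : Type*} [Fintype M] {n : ℕ}

lemma bundleVal_nonneg {v : M → ℝ} (hv : ∀ e, 0 ≤ v e) (f : M → Fin n) (j : Fin n) :
    0 ≤ bundleVal v f j :=
  Finset.sum_nonneg fun e _ => hv e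

lemma le_bundleVal {v : M → ℝ} (hv : ∀ e, 0 ≤ v e) (f : M → Fin n) (e : M) :
    v e ≤ bundleVal v f (f e) :=
  Finset.single_le_sum (f := v) (fun e _ => hv e) (by simp)

lemma bundleVal_add_mul (v w : M → ℝ) (ε : ℝ) (f : M → Fin n) (j : Fin n) :
    bundleVal (fun e => v e + ε * w e) f j = bundleVal v f j + ε * bundleVal w f j := by
  simp [bundleVal, Finset.sum_add_distrib, Finset.mul_sum]

lemma bundleVal_map_sub (φ : ℝ →ₗ[ℚ] ℚ) (v : M → ℝ) (f : M → Fin n) (j : Fin n) :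
    bundleVal (fun e => (φ (v e) : ℝ) - v e) f j = φ (bundleVal v f j) - bundleVal v f j := by
  simp [bundleVal, Finset.sum_sub_distrib]

/-- Merging the items in each fibre of `π` does not change the value of a bundle that is a union
of fibres. -/
lemma bundleVal_fiberwise {C : Type*} [Fintype C] [DecidableEq C] (v : M → ℝ) (π : M → C)
    (f : C → Fin n) (j : Fin n) :
    bundleVal (fun c => ∑ e ∈ Finset.univ.filter (fun e => π e = c), v e) f j =
      bundleVal v (f ∘ π) j := by
  simp only [bundleVal, Finset.sum_filter, Function.comp_apply]
  calc _ = ∑ c, ∑ e, if π e = c then (if f c = j then v e else 0) else 0 := by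
        refine Finset.sum_congr rfl fun c _ => ?_
        split_ifs <;> simp
    _ = _ := by
        rw [Finset.sum_comm]
        simp

lemma exists_MMS_le_bundleVal [DecidableEq M] [NeZero n] (v : M → ℝ) :
    ∃ f : M → Fin n, ∀ j, MMS n v ≤ bundleVal v f j := by
  obtain ⟨f, -, hf⟩ := Finset.exists_mem_eq_sup' (Finset.univ_nonempty (α := M → Fin n))
    fun f => Finset.univ.inf' Finset.univ_nonempty fun j => bundleVal v f j
  exact ⟨f, fun j => hf.trans_le (Finset.inf'_le _ (Finset.mem_univ j))⟩

lemma le_MMS [DecidableEq M] [NeZero n] {v : M → ℝ} {t : ℝ} (f : M → Fin n)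
    (h : ∀ j, t ≤ bundleVal v f j) : t ≤ MMS n v :=
  (Finset.le_inf' _ _ fun j _ => h j).trans (Finset.le_sup' (fun f : M → Fin n =>
    Finset.univ.inf' Finset.univ_nonempty fun j => bundleVal v f j) (Finset.mem_univ f))

end BundleVal

/-- The profiles on the items `Fin n → Fin n` for which the `i`-th coordinate partitions the
items into bundles that agent `i` values at exactly `1`. -/
def gridProfiles (n : ℕ) : Set (Fin n → (Fin n → Fin n) → ℝ) :=
  {v | (∀ i e, 0 ≤ v i e) ∧ ∀ i j, bundleVal (v i) (fun e => e i) j = 1}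

/-- The largest value that some allocation guarantees to all agents simultaneously. -/
noncomputable def egalitarianValue {M : Type*} [Fintype M] [DecidableEq M] (n : ℕ) [NeZero n]
    (v : Fin n → M → ℝ) : ℝ :=
  Finset.univ.sup' Finset.univ_nonempty fun A : M → Fin n =>
    Finset.univ.inf' Finset.univ_nonempty fun i => bundleVal (v i) A i

section EgalitarianValue

variable {M : Type*} [Fintype M] [DecidableEq M] {n : ℕ} [NeZero n]

lemma egalitarianValue_le_iff {v : Fin n → M → ℝ} {t : ℝ} :
    egalitarianValue n v ≤ t ↔ ∀ A : M → Fin n, ∃ i, bundleVal (v i) A i ≤ t := by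
  simp [egalitarianValue]

lemma le_egalitarianValue_iff {v : Fin n → M → ℝ} {t : ℝ} :
    t ≤ egalitarianValue n v ↔ ∃ A : M → Fin n, ∀ i, t ≤ bundleVal (v i) A i := by
  simp [egalitarianValue]

lemma continuous_egalitarianValue :
    Continuous (egalitarianValue n : (Fin n → M → ℝ) → ℝ) := by
  unfold egalitarianValue
  refine Continuous.finset_sup'_apply _ fun A _ => Continuous.finset_inf'_apply _ fun i _ => ?_
  unfold bundleVal
  fun_prop

end EgalitarianValue

lemma gridProfiles_nonempty (n : ℕ) : (gridProfiles n).Nonempty := by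
  refine ⟨fun i e => if e = (fun _ => e i) then 1 else 0, fun i e => ?_, fun i j => ?_⟩
  · dsimp only
    split_ifs <;> norm_num
  · unfold bundleVal
    rw [Finset.sum_eq_single (fun _ => j)]
    · simp
    · intro e he hne
      have hej : e i = j := by simpa using he
      simp [hej, hne]
    · simp

lemma isCompact_gridProfiles (n : ℕ) : IsCompact (gridProfiles n) := by
  refine (isCompact_Icc (a := (0 : Fin n → (Fin n → Fin n) → ℝ)) (b := 1)).of_isClosed_subset
    ?_ fun v hv => ⟨fun i e => hv.1 i e, fun i e => ?_⟩
  · simp only [gridProfiles, bundleVal, Set.ofPred_and, Set.ofPred_forall]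
    refine IsClosed.inter ?_ ?_
    · exact isClosed_iInter fun i => isClosed_iInter fun e =>
        isClosed_le (by fun_prop) (by fun_prop)
    · exact isClosed_iInter fun i => isClosed_iInter fun j =>
        isClosed_eq (by fun_prop) (by fun_prop)
  · exact (le_bundleVal (hv.1 i) (fun e => e i) e).trans_eq (hv.2 i (e i))

lemma eventually_add_mul_lt_add_mul {a b : ℝ} (h : a < b) (x y : ℝ) :
    ∀ᶠ ε in 𝓝 (0 : ℝ), a + ε * x < b + ε * y := by
  have hx : ContinuousAt (fun ε : ℝ => a + ε * x) 0 := by fun_prop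
  have hy : ContinuousAt (fun ε : ℝ => b + ε * y) 0 := by fun_prop
  exact hx.eventually_lt hy (by simpa using h)

/-- The minimum of the egalitarian value over `gridProfiles n` is rational. A `ℚ`-linear
retraction `φ : ℝ → ℚ` preserves every rational equation tight at a minimizer `v`, so moving
from `v` slightly towards or away from `φ ∘ v` stays feasible. -/
lemma IsMinOn.egalitarianValue_rational {n : ℕ} [NeZero n] {v : Fin n → (Fin n → Fin n) → ℝ}
    (hv : v ∈ gridProfiles n) (hmin : IsMinOn (egalitarianValue n) (gridProfiles n) v) :
    ∃ q : ℚ, (q : ℝ) = egalitarianValue n v := by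
  obtain ⟨φ, hφ⟩ := (Algebra.linearMap ℚ ℝ).exists_leftInverse_of_injective
    (LinearMap.ker_eq_bot.2 (algebraMap ℚ ℝ).injective)
  have hφ1 : φ 1 = 1 := by simpa using LinearMap.congr_fun hφ 1
  set t := egalitarianValue n v with ht
  refine ⟨φ t, sub_eq_zero.1 ?_⟩
  set d : ℝ := φ t - t
  let w : Fin n → (Fin n → Fin n) → ℝ := fun i e => φ (v i e) - v i e
  have hw : ∀ (i : Fin n) (A : (Fin n → Fin n) → Fin n) (j : Fin n),
      bundleVal (w i) A j = φ (bundleVal (v i) A j) - bundleVal (v i) A j :=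
    fun i A j => bundleVal_map_sub φ (v i) A j
  have hfeas : ∀ᶠ ε in 𝓝 (0 : ℝ), (fun i e => v i e + ε * w i e) ∈ gridProfiles n := by
    have hnonneg : ∀ᶠ ε in 𝓝 (0 : ℝ), ∀ i e, 0 ≤ v i e + ε * w i e := by
      refine eventually_all.2 fun i => eventually_all.2 fun e => ?_
      rcases (hv.1 i e).eq_or_lt with h | h
      · simp [w, ← h]
      · filter_upwards [eventually_add_mul_lt_add_mul h 0 (w i e)] with ε hε
        linarith
    filter_upwards [hnonneg] with ε hε
    refine ⟨hε, fun i j => ?_⟩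
    rw [bundleVal_add_mul, hw, hv.2, hφ1]
    simp
  have hval : ∀ᶠ ε in 𝓝 (0 : ℝ),
      egalitarianValue n (fun i e => v i e + ε * w i e) ≤ t + ε * d := by
    simp only [egalitarianValue_le_iff, bundleVal_add_mul]
    refine eventually_all.2 fun A => ?_
    obtain ⟨i, hi⟩ := egalitarianValue_le_iff.1 ht.ge A
    rcases hi.eq_or_lt with h | h
    · exact Eventually.of_forall fun ε => ⟨i, by rw [hw, h]⟩
    · filter_upwards [eventually_add_mul_lt_add_mul h (bundleVal (w i) A i) d] with ε hε
      exact ⟨i, hε.le⟩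
  have hloc : IsLocalMin (fun ε : ℝ => t + ε * d) 0 := by
    filter_upwards [hfeas, hval] with ε h1 h2
    rw [zero_mul, add_zero]
    exact (hmin h1).trans h2
  have hder : HasDerivAt (fun ε : ℝ => t + ε * d) d 0 := by
    simpa using ((hasDerivAt_id (0 : ℝ)).mul_const d).const_add t
  exact hloc.hasDerivAt_eq_zero hder

/-- A lower bound for the egalitarian value on `gridProfiles n` is an MMS approximation ratio
that can be guaranteed in every instance: merge the items that no agent's MMS partition
separates. -/
lemma exists_allocation_of_le_egalitarianValue {n : ℕ} [NeZero n] {t : ℝ}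
    (ht : ∀ u ∈ gridProfiles n, t ≤ egalitarianValue n u) {M : Type*} [Fintype M]
    [DecidableEq M] {v : Fin n → M → ℝ} (hv : ∀ i e, 0 ≤ v i e) :
    ∃ A : M → Fin n, ∀ i, t * MMS n (v i) ≤ bundleVal (v i) A i := by
  choose P hP using fun i => exists_MMS_le_bundleVal (n := n) (v i)
  obtain ⟨u₀, hu₀⟩ := gridProfiles_nonempty n
  let π : M → Fin n → Fin n := fun e i => P i e
  let m : Fin n → (Fin n → Fin n) → ℝ := fun i c =>
    ∑ e ∈ Finset.univ.filter (fun e => π e = c), v i e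
  have hm : ∀ i c, 0 ≤ m i c := fun i c => Finset.sum_nonneg fun e _ => hv i e
  let u : Fin n → (Fin n → Fin n) → ℝ := fun i c =>
    if 0 < MMS n (v i) then m i c / bundleVal (v i) (P i) (c i) else u₀ i c
  have hu : u ∈ gridProfiles n := by
    refine ⟨fun i c => ?_, fun i j => ?_⟩
    · dsimp only [u]
      split_ifs
      · exact div_nonneg (hm i c) (bundleVal_nonneg (hv i) _ _)
      · exact hu₀.1 i c
    · by_cases h : 0 < MMS n (v i)
      · have hpos : 0 < bundleVal (v i) (P i) j := h.trans_le (hP i j)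
        have hsum : bundleVal (m i) (fun c => c i) j = bundleVal (v i) (P i) j :=
          bundleVal_fiberwise (v i) π (fun c => c i) j
        calc bundleVal (u i) (fun c => c i) j
            = bundleVal (m i) (fun c => c i) j / bundleVal (v i) (P i) j := by
              rw [bundleVal, bundleVal, Finset.sum_div]
              refine Finset.sum_congr rfl fun c hc => ?_
              have hcj : c i = j := by simpa using hc
              simp [u, h, hcj]
          _ = 1 := by rw [hsum, div_self hpos.ne']
      · have hui : u i = u₀ i := by
          funext c
          simp [u, h]
        rw [hui, hu₀.2]
  obtain ⟨A, hA⟩ := le_egalitarianValue_iff.1 (ht u hu)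
  refine ⟨A ∘ π, fun i => ?_⟩
  by_cases h : 0 < MMS n (v i)
  · rw [← bundleVal_fiberwise]
    calc t * MMS n (v i) ≤ bundleVal (u i) A i * MMS n (v i) :=
          mul_le_mul_of_nonneg_right (hA i) h.le
      _ ≤ bundleVal (m i) A i := by
          rw [bundleVal, Finset.sum_mul]
          refine Finset.sum_le_sum fun c _ => ?_
          have hpos : 0 < bundleVal (v i) (P i) (c i) := h.trans_le (hP i _)
          calc u i c * MMS n (v i) ≤ u i c * bundleVal (v i) (P i) (c i) :=
                mul_le_mul_of_nonneg_left (hP i _) (hu.1 i c)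
            _ = m i c := by simp [u, h, hpos.ne']
  · have h0 : MMS n (v i) = 0 :=
      le_antisymm (not_lt.1 h) (le_MMS (P i) fun j => bundleVal_nonneg (hv i) _ _)
    rw [h0, mul_zero]
    exact bundleVal_nonneg (hv i) _ _

/-- The optimal MMS approximation ratio is rational, and it is attained by an instance in which
every agent has a positive maximin share. -/
theorem exists_rational_ratio_attained_of_MMS_pos (n : ℕ) [NeZero n] :
    ∃ q : ℚ,
      (∀ (M : Type) [Fintype M] [DecidableEq M] (v : Fin n → M → ℝ), (∀ i e, 0 ≤ v i e) →
        ∃ A : M → Fin n, ∀ i, (q : ℝ) * MMS n (v i) ≤ bundleVal (v i) A i) ∧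
      ∃ v : Fin n → (Fin n → Fin n) → ℝ, (∀ i e, 0 ≤ v i e) ∧ (∀ i, 0 < MMS n (v i)) ∧
        ∀ A : (Fin n → Fin n) → Fin n, ∃ i, bundleVal (v i) A i ≤ (q : ℝ) * MMS n (v i) := by
  obtain ⟨v, hv, hmin⟩ := (isCompact_gridProfiles n).exists_isMinOn (gridProfiles_nonempty n)
    continuous_egalitarianValue.continuousOn
  obtain ⟨q, hq⟩ := hmin.egalitarianValue_rational hv
  have hMMS : ∀ i, 1 ≤ MMS n (v i) := fun i => le_MMS (fun e => e i) fun j => (hv.2 i j).ge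
  refine ⟨q, fun M _ _ w hw => exists_allocation_of_le_egalitarianValue
    (fun u hu => hq.trans_le (hmin hu)) hw, v, hv.1, fun i => one_pos.trans_le (hMMS i),
    fun A => ?_⟩
  have hq0 : (0 : ℝ) ≤ q :=
    hq ▸ le_egalitarianValue_iff.2 ⟨A, fun i => bundleVal_nonneg (hv.1 i) _ _⟩
  obtain ⟨i, hi⟩ := egalitarianValue_le_iff.1 hq.ge A
  exact ⟨i, hi.trans (le_mul_of_one_le_right hq0 (hMMS i))⟩

/-- For every n ≥ 1, the optimal MMS approximation ratio for n agents with
additive nonnegative valuations exists and is a rational number q. -/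
theorem optimal_mms_ratio_rational (n : ℕ) [NeZero n] :
    ∃ q : ℚ,
      (∀ (M : Type) (i1 : Fintype M) (i2 : DecidableEq M) (v : Fin n → M → ℝ),
        (∀ i e, 0 ≤ v i e) →
        ∃ A : M → Fin n, ∀ i,
          (q : ℝ) * @MMS M i1 i2 n _ (v i) ≤ @bundleVal M i1 n (v i) A i) ∧
      (∃ (M : Type) (i1 : Fintype M) (i2 : DecidableEq M) (v : Fin n → M → ℝ),
        (∀ i e, 0 ≤ v i e) ∧
        ∀ A : M → Fin n, ∃ i,
          @bundleVal M i1 n (v i) A i ≤ (q : ℝ) * @MMS M i1 i2 n _ (v i)) := by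
  obtain ⟨q, hq, v, hv, -, hA⟩ := exists_rational_ratio_attained_of_MMS_pos n
  exact ⟨q, fun M _ _ w hw => hq M w hw, _, inferInstance, inferInstance, v, hv, hA⟩
end

section
/- For every instance with three agents having additive nonnegative cost functions over a finite set of chores, and for every prespecified agent u among the three, there exists an allocation A = (A_1,A_2,A_3) in which agent u receives cost at most her proportional share, v^u(A_u) ≤ PS^u, and each of the other two agents i receives cost v^i(A_i) ≤ (19/18)·mmS^i. (That is, a (19/18)-P⁺mm allocation always exists for chores.) -/
/-- The weight of the `k`-th part when the cells of a 3 × 3 grid are partitioned by `T`. -/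
def gridLoad (X : Fin 3 → Fin 3 → ℝ) (T : Fin 3 → Fin 3 → Fin 3) (k : Fin 3) : ℝ :=
  ∑ i, ∑ j, if T i j = k then X i j else 0

/-- The weight of the items in row `i` of the partition `f` and column `j` of the partition `g`. -/
noncomputable def cell {M : Type*} [Fintype M] (w : M → ℝ) (f g : M → Fin 3) (i j : Fin 3) : ℝ :=
  ∑ e, if f e = i ∧ g e = j then w e else 0

/-- No partition of the entries of `c` and `d` into two parts has both sums at most `t`. -/
def Unsplittable (t : ℝ) (c d : Fin 3 → ℝ) : Prop :=
  ∀ p q : Fin 3 → Bool,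
    t < ∑ i, ((if p i then c i else 0) + if q i then d i else 0) ∨
    t < ∑ i, ((if p i then 0 else c i) + if q i then 0 else d i)

/-- Upper bounds on bundles of grid cells, where the row `k` is special and the columns
`0`, `1`, `2` play different roles. -/
def Shape (X : Fin 3 → Fin 3 → ℝ) (t : ℝ) (k : Fin 3) : Prop :=
  ∀ i j, i ≠ k → j ≠ k → i ≠ j →
    X i 0 + X j 0 + X k 0 ≤ t ∧ X k 0 + X k 1 + X k 2 ≤ t ∧
    X i 0 + X i 1 + X i 2 + X k 0 ≤ t ∧ X i 0 + X i 1 + X j 1 + X k 0 ≤ t ∧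
    X i 1 + X k 0 + X k 1 ≤ t ∧ X i 1 + X i 2 + X k 0 + X k 2 ≤ t

/-- There is an allocation giving the first agent at most her proportional share, the second
cost at most `α`, and the third cost at most `β`. -/
def Solvable {M : Type*} [Fintype M] (z x y : M → ℝ) (α β : ℝ) : Prop :=
  ∃ A : M → Fin 3, bundleVal z A 0 ≤ PS 3 z ∧ bundleVal x A 1 ≤ α ∧ bundleVal y A 2 ≤ β

lemma exists_perm_three (i j k : Fin 3) (hij : i ≠ j) (hik : i ≠ k) (hjk : j ≠ k) :
    ∃ σ : Equiv.Perm (Fin 3), σ 0 = i ∧ σ 1 = j ∧ σ 2 = k := by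
  revert i j k
  decide

lemma exists_ne_ne_fin_three : ∀ i j : Fin 3, ∃ r, r ≠ i ∧ r ≠ j := by
  decide

lemma Unsplittable.comp_perm {t : ℝ} {c d : Fin 3 → ℝ} (h : Unsplittable t c d)
    (σ : Equiv.Perm (Fin 3)) : Unsplittable t (fun i => c (σ i)) (fun i => d (σ i)) := by
  intro p q
  rcases h (fun i => p (σ.symm i)) (fun i => q (σ.symm i)) with h | h
  · left
    rw [← Equiv.sum_comp σ] at h
    simpa using h
  · right
    rw [← Equiv.sum_comp σ] at h
    simpa using h

/-- The bounds of `Shape` when row `2` is special because it contains a largest entry. -/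
lemma bounds_of_unsplittable {x : Fin 3 → Fin 3 → ℝ} {a : ℝ} (hpos : ∀ i j, 0 ≤ x i j)
    (hrow : ∀ i, x i 0 + x i 1 + x i 2 ≤ 18 * a)
    (hcol₁ : 19 * a < x 0 1 + x 1 1 + x 2 1) (hcol₂ : 19 * a < x 0 2 + x 1 2 + x 2 2)
    (hmax₁ : ∀ i, x i 1 ≤ x 2 1) (hmax₂ : ∀ i, x i 2 ≤ x 2 1)
    (h1 : Unsplittable (19 * a) (fun i => x i 0) (fun i => x i 1))
    (h2 : Unsplittable (19 * a) (fun i => x i 0) (fun i => x i 2)) :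
    x 0 0 + x 0 1 + x 0 2 + x 2 0 ≤ 19 * a ∧ x 0 0 + x 0 1 + x 1 1 + x 2 0 ≤ 19 * a ∧
    x 0 1 + x 2 0 + x 2 1 ≤ 19 * a ∧ x 0 1 + x 0 2 + x 2 0 + x 2 2 ≤ 19 * a := by
  unfold Unsplittable at h1 h2
  simp only [Fin.sum_univ_three] at h1 h2
  have r0 := hrow 0
  have r1 := hrow 1
  have r2 := hrow 2
  have m0 := hmax₁ 0
  have m1 := hmax₁ 1
  have m2 := hmax₂ 0
  have m3 := hmax₂ 1
  have m4 := hmax₂ 2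
  have n00 := hpos 0 0
  have n01 := hpos 0 1
  have n02 := hpos 0 2
  have n10 := hpos 1 0
  have n11 := hpos 1 1
  have n12 := hpos 1 2
  have n20 := hpos 2 0
  have n21 := hpos 2 1
  have n22 := hpos 2 2
  have b1 : 19 * a < x 0 0 + x 0 2 + x 1 0 := by
    rcases h2 ![true, true, false] ![true, false, false] with h | h <;> simp at h <;> linarith
  have b2 : 19 * a < x 0 0 + x 0 1 + x 1 0 + x 1 1 := by
    rcases h1 ![true, true, false] ![true, true, false] with h | h <;> simp at h <;> linarith
  have b3 : 19 * a < x 0 0 + x 1 0 + x 2 0 + x 2 2 := by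
    rcases h2 ![true, true, true] ![false, false, true] with h | h <;> simp at h <;> linarith
  have b4 : 19 * a < x 0 0 + x 1 0 + x 1 2 := by
    rcases h2 ![true, true, false] ![false, true, false] with h | h <;> simp at h <;> linarith
  have b5 : 19 * a < x 0 0 + x 0 2 + x 2 0 + x 2 2 := by
    rcases h2 ![true, false, true] ![true, false, true] with h | h <;> simp at h <;> linarith
  have b6 : 19 * a < x 0 0 + x 1 0 + x 1 1 + x 2 0 := by
    rcases h1 ![true, true, true] ![false, true, false] with h | h <;> simp at h <;> linarith
  have b7 : 19 * a < x 0 0 + x 1 1 + x 2 0 + x 2 1 := by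
    rcases h1 ![true, false, true] ![false, true, true] with h | h <;> simp at h <;> linarith
  have b8 : 19 * a < x 1 0 + x 1 2 + x 2 0 + x 2 2 := by
    rcases h2 ![true, false, false] ![true, false, false] with h | h <;> simp at h <;> linarith
  have b9 : 19 * a < x 0 0 + x 0 1 + x 1 0 + x 2 0 := by
    rcases h1 ![true, true, true] ![true, false, false] with h | h <;> simp at h <;> linarith
  have b10 : 19 * a < x 0 1 + x 1 0 + x 2 0 + x 2 1 := by
    rcases h1 ![true, false, false] ![false, true, false] with h | h <;> simp at h <;> linarith
  have b11 : 19 * a < x 0 0 + x 0 2 + x 1 2 ∨ 19 * a < x 1 0 + x 2 0 + x 2 2 := by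
    rcases h2 ![true, false, false] ![true, true, false] with h | h <;> simp at h
    · left; linarith
    · right; linarith
  rcases b11 with b11 | b11
  · have b12 : 19 * a < x 0 0 + x 2 0 + x 2 1 := by
      rcases h1 ![true, false, true] ![false, false, true] with h | h <;> simp at h <;> linarith
    have b13 : 19 * a < x 0 0 + x 0 2 + x 2 2 ∨ 19 * a < x 1 0 + x 1 2 + x 2 0 := by
      rcases h2 ![true, false, false] ![true, false, true] with h | h <;> simp at h
      · left; linarith
      · right; linarith
    rcases b13 with b13 | b13
    · have b14 : 19 * a < x 0 0 + x 1 0 + x 1 1 := by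
        rcases h1 ![true, true, false] ![false, true, false] with h | h <;> simp at h <;> linarith
      have b15 : 19 * a < x 1 0 + x 1 2 + x 2 2 := by
        rcases h2 ![true, false, true] ![true, false, false] with h | h <;> simp at h <;> linarith
      have b16 : 19 * a < x 0 0 + x 2 1 := by
        rcases h1 ![true, false, false] ![false, false, true] with h | h <;> simp at h <;> linarith
      have b17 : 19 * a < x 0 0 + x 0 1 + x 1 0 := by
        rcases h1 ![true, true, false] ![true, false, false] with h | h <;> simp at h <;> linarith
      have b18 : 19 * a < x 0 0 + x 2 0 + x 2 2 ∨ 19 * a < x 0 2 + x 1 0 + x 1 2 := by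
        rcases h2 ![true, false, true] ![false, false, true] with h | h <;> simp at h
        · left; linarith
        · right; linarith
      rcases b18 with b18 | b18
      · have b19 : 19 * a < x 0 2 + x 1 0 + x 2 2 := by
          rcases h2 ![true, false, true] ![false, true, false] with h | h <;> simp at h <;> linarith
        exfalso; linarith
      · have b20 : 19 * a < x 1 0 + x 2 0 + x 2 1 := by
          rcases h1 ![true, false, false] ![true, true, false] with h | h <;> simp at h <;> linarith
        exact ⟨by linarith, by linarith, by linarith, by linarith⟩
    · have b21 : 19 * a < x 1 0 + x 1 2 + x 2 2 := by
        rcases h2 ![true, false, true] ![true, false, false] with h | h <;> simp at h <;> linarith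
      exfalso; linarith
  · have b22 : 19 * a < x 0 2 + x 1 0 + x 2 0 := by
      rcases h2 ![true, false, false] ![false, true, true] with h | h <;> simp at h <;> linarith
    exfalso; linarith

lemma shape_of_unsplittable {x : Fin 3 → Fin 3 → ℝ} {a : ℝ} {k : Fin 3} (hpos : ∀ i j, 0 ≤ x i j)
    (hrow : ∀ i, x i 0 + x i 1 + x i 2 ≤ 18 * a)
    (hcol₀ : ∑ i, x i 0 ≤ 19 * a) (hcol₁ : 19 * a < ∑ i, x i 1) (hcol₂ : 19 * a < ∑ i, x i 2)
    (hmax₁ : ∀ i, x i 1 ≤ x k 1) (hmax₂ : ∀ i, x i 2 ≤ x k 1)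
    (h1 : Unsplittable (19 * a) (fun i => x i 0) (fun i => x i 1))
    (h2 : Unsplittable (19 * a) (fun i => x i 0) (fun i => x i 2)) :
    Shape x (19 * a) k := by
  intro i j hi hj hij
  obtain ⟨σ, hσi, hσj, hσk⟩ := exists_perm_three i j k hij hi hj
  rw [← Equiv.sum_comp σ, Fin.sum_univ_three, hσi, hσj, hσk] at hcol₀ hcol₁ hcol₂
  have h := bounds_of_unsplittable (x := fun r => x (σ r)) (a := a) (fun r => hpos (σ r))
    (fun r => hrow (σ r)) (by simpa only [hσi, hσj, hσk] using hcol₁)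
    (by simpa only [hσi, hσj, hσk] using hcol₂)
    (fun r => by simpa only [hσk] using hmax₁ (σ r))
    (fun r => by simpa only [hσk] using hmax₂ (σ r)) (h1.comp_perm σ) (h2.comp_perm σ)
  simp only [hσi, hσj, hσk] at h
  have hk := hrow k
  have n0 := hpos k 0
  have n1 := hpos k 1
  have n2 := hpos k 2
  exact ⟨hcol₀, by linarith, h⟩

lemma Shape.comp_perm {X : Fin 3 → Fin 3 → ℝ} {t : ℝ} {k : Fin 3} (h : Shape X t k)
    (σ : Equiv.Perm (Fin 3)) : Shape (fun i j => X (σ.symm i) j) t (σ k) := by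
  intro i j hi hj hij
  simpa using h (σ.symm i) (σ.symm j) (by rwa [Ne, Equiv.symm_apply_eq])
    (by rwa [Ne, Equiv.symm_apply_eq]) (by simpa using hij)

/-- Two shapes, one of them transposed, admit a partition of the grid in which the first weight
accepts parts `0` and `1` and the second one accepts parts `1` and `2`. -/
lemma exists_gridLoad_le {X Y : Fin 3 → Fin 3 → ℝ} {α β : ℝ} {k l : Fin 3}
    (hX : ∀ i j, 0 ≤ X i j) (hY : ∀ i j, 0 ≤ Y i j)
    (sX : Shape X α k) (sY : Shape (fun j i => Y i j) β l) :
    ∃ T, gridLoad X T 0 ≤ α ∧ gridLoad X T 1 ≤ α ∧ gridLoad Y T 1 ≤ β ∧ gridLoad Y T 2 ≤ β := by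
  have hx : ∀ i, 0 ≤ X i 0 ∧ 0 ≤ X i 1 ∧ 0 ≤ X i 2 := fun i => ⟨hX i 0, hX i 1, hX i 2⟩
  have hy : ∀ i, 0 ≤ Y i 0 ∧ 0 ≤ Y i 1 ∧ 0 ≤ Y i 2 := fun i => ⟨hY i 0, hY i 1, hY i 2⟩
  have x0 := hx 0
  have x1 := hx 1
  have x2 := hx 2
  have y0 := hy 0
  have y1 := hy 1
  have y2 := hy 2
  simp only [Shape, gridLoad, Fin.sum_univ_three] at sX sY ⊢
  fin_cases k <;> fin_cases l
  · have a1 := sX 1 2 (by decide) (by decide) (by decide)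
    have a2 := sX 2 1 (by decide) (by decide) (by decide)
    have b1 := sY 1 2 (by decide) (by decide) (by decide)
    have b2 := sY 2 1 (by decide) (by decide) (by decide)
    refine ⟨![![0, 2, 0], ![1, 2, 2], ![1, 0, 0]], ?_⟩
    simp at a1 a2 b1 b2 ⊢
    refine ⟨?_, ?_, ?_, ?_⟩ <;> linarith
  · have a1 := sX 1 2 (by decide) (by decide) (by decide)
    have a2 := sX 2 1 (by decide) (by decide) (by decide)
    have b1 := sY 0 2 (by decide) (by decide) (by decide)
    have b2 := sY 2 0 (by decide) (by decide) (by decide)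
    refine ⟨![![0, 2, 2], ![2, 0, 2], ![0, 0, 1]], ?_⟩
    simp at a1 a2 b1 b2 ⊢
    refine ⟨?_, ?_, ?_, ?_⟩ <;> linarith
  · have a1 := sX 1 2 (by decide) (by decide) (by decide)
    have a2 := sX 2 1 (by decide) (by decide) (by decide)
    have b1 := sY 0 1 (by decide) (by decide) (by decide)
    have b2 := sY 1 0 (by decide) (by decide) (by decide)
    refine ⟨![![0, 2, 2], ![1, 2, 1], ![0, 0, 0]], ?_⟩
    simp at a1 a2 b1 b2 ⊢
    refine ⟨?_, ?_, ?_, ?_⟩ <;> linarith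
  · have a1 := sX 0 2 (by decide) (by decide) (by decide)
    have a2 := sX 2 0 (by decide) (by decide) (by decide)
    have b1 := sY 1 2 (by decide) (by decide) (by decide)
    have b2 := sY 2 1 (by decide) (by decide) (by decide)
    refine ⟨![![1, 2, 1], ![0, 2, 2], ![0, 0, 0]], ?_⟩
    simp at a1 a2 b1 b2 ⊢
    refine ⟨?_, ?_, ?_, ?_⟩ <;> linarith
  · have a1 := sX 0 2 (by decide) (by decide) (by decide)
    have a2 := sX 2 0 (by decide) (by decide) (by decide)
    have b1 := sY 0 2 (by decide) (by decide) (by decide)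
    have b2 := sY 2 0 (by decide) (by decide) (by decide)
    refine ⟨![![1, 1, 1], ![0, 2, 2], ![0, 0, 0]], ?_⟩
    simp at a1 a2 b1 b2 ⊢
    refine ⟨?_, ?_, ?_, ?_⟩ <;> linarith
  · have a1 := sX 0 2 (by decide) (by decide) (by decide)
    have a2 := sX 2 0 (by decide) (by decide) (by decide)
    have b1 := sY 0 1 (by decide) (by decide) (by decide)
    have b2 := sY 1 0 (by decide) (by decide) (by decide)
    refine ⟨![![1, 1, 1], ![0, 2, 2], ![0, 0, 0]], ?_⟩
    simp at a1 a2 b1 b2 ⊢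
    refine ⟨?_, ?_, ?_, ?_⟩ <;> linarith
  · have a1 := sX 0 1 (by decide) (by decide) (by decide)
    have a2 := sX 1 0 (by decide) (by decide) (by decide)
    have b1 := sY 1 2 (by decide) (by decide) (by decide)
    have b2 := sY 2 1 (by decide) (by decide) (by decide)
    refine ⟨![![2, 0, 2], ![1, 1, 2], ![0, 0, 2]], ?_⟩
    simp at a1 a2 b1 b2 ⊢
    refine ⟨?_, ?_, ?_, ?_⟩ <;> linarith
  · have a1 := sX 0 1 (by decide) (by decide) (by decide)
    have a2 := sX 1 0 (by decide) (by decide) (by decide)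
    have b1 := sY 0 2 (by decide) (by decide) (by decide)
    have b2 := sY 2 0 (by decide) (by decide) (by decide)
    refine ⟨![![1, 2, 2], ![1, 0, 2], ![0, 0, 2]], ?_⟩
    simp at a1 a2 b1 b2 ⊢
    refine ⟨?_, ?_, ?_, ?_⟩ <;> linarith
  · have a1 := sX 0 1 (by decide) (by decide) (by decide)
    have a2 := sX 1 0 (by decide) (by decide) (by decide)
    have b1 := sY 0 1 (by decide) (by decide) (by decide)
    have b2 := sY 1 0 (by decide) (by decide) (by decide)
    refine ⟨![![1, 2, 2], ![1, 0, 0], ![0, 2, 0]], ?_⟩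
    simp at a1 a2 b1 b2 ⊢
    refine ⟨?_, ?_, ?_, ?_⟩ <;> linarith

section Allocations

variable {M : Type*} [Fintype M]

lemma bundleVal_comp_perm (w : M → ℝ) (S : M → Fin 3) (σ : Equiv.Perm (Fin 3)) (k : Fin 3) :
    bundleVal w (fun e => σ (S e)) k = bundleVal w S (σ.symm k) := by
  simp [bundleVal, Equiv.eq_symm_apply]

lemma sum_bundleVal (w : M → ℝ) (S : M → Fin 3) : ∑ k, bundleVal w S k = ∑ e, w e :=
  Finset.sum_fiberwise Finset.univ S w

lemma bundleVal_nonneg_s10 {w : M → ℝ} (hw : ∀ e, 0 ≤ w e) (S : M → Fin 3) (k : Fin 3) :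
    0 ≤ bundleVal w S k :=
  Finset.sum_nonneg fun e _ => hw e

lemma exists_bundleVal_le_PS (w : M → ℝ) (S : M → Fin 3) : ∃ k, bundleVal w S k ≤ PS 3 w := by
  by_contra! h
  have hs := sum_bundleVal w S
  rw [Fin.sum_univ_three] at hs
  have h0 := h 0
  have h1 := h 1
  have h2 := h 2
  simp only [PS, Nat.cast_ofNat] at h0 h1 h2
  linarith

lemma cell_nonneg {w : M → ℝ} (hw : ∀ e, 0 ≤ w e) (f g : M → Fin 3) (i j : Fin 3) :
    0 ≤ cell w f g i j :=
  Finset.sum_nonneg fun e _ => by split_ifs <;> simp [hw]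

lemma sum_cell_row (w : M → ℝ) (f g : M → Fin 3) (i : Fin 3) :
    ∑ j, cell w f g i j = bundleVal w f i := by
  simp only [cell, bundleVal, Finset.sum_filter]
  rw [Finset.sum_comm]
  refine Finset.sum_congr rfl fun e _ => ?_
  by_cases h : f e = i <;> simp [h]

lemma cell_swap (w : M → ℝ) (f g : M → Fin 3) (i j : Fin 3) :
    cell w f g i j = cell w g f j i := by
  simp only [cell, and_comm]

lemma sum_cell_col (w : M → ℝ) (f g : M → Fin 3) (j : Fin 3) :
    ∑ i, cell w f g i j = bundleVal w g j := by
  simp only [cell_swap w f g, sum_cell_row]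

lemma cell_comp_perm (w : M → ℝ) (f g : M → Fin 3) (σ τ : Equiv.Perm (Fin 3)) (i j : Fin 3) :
    cell w (fun e => σ (f e)) (fun e => τ (g e)) i j = cell w f g (σ.symm i) (τ.symm j) := by
  simp [cell, Equiv.eq_symm_apply]

lemma bundleVal_grid (w : M → ℝ) (f g : M → Fin 3) (T : Fin 3 → Fin 3 → Fin 3) (k : Fin 3) :
    bundleVal w (fun e => T (f e) (g e)) k = gridLoad (cell w f g) T k := by
  have h : ∀ i j, (if T i j = k then cell w f g i j else 0) =
      ∑ e, if f e = i ∧ g e = j then (if T i j = k then w e else 0) else 0 := by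
    intro i j
    by_cases h : T i j = k <;> simp [h, cell]
  simp only [gridLoad, h, bundleVal, Finset.sum_filter]
  simp_rw [Finset.sum_comm (t := (Finset.univ : Finset M))]
  refine Finset.sum_congr rfl fun e _ => ?_
  rw [Finset.sum_eq_single (f e) (fun i _ hi => by simp [hi.symm]) (by simp),
    Finset.sum_eq_single (g e) (fun i _ hi => by simp [hi.symm]) (by simp)]
  simp

variable {z x y : M → ℝ} {α β : ℝ}

lemma Solvable.symm (h : Solvable z x y α β) : Solvable z y x β α := by
  obtain ⟨A, h0, h1, h2⟩ := h
  refine ⟨fun e => Equiv.swap 1 2 (A e), ?_, ?_, ?_⟩ <;> rw [bundleVal_comp_perm]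
  · simpa [Equiv.swap_apply_of_ne_of_ne] using h0
  · simpa using h2
  · simpa using h1

/-- Cut and choose: the first agent chooses a part of `S`. -/
lemma solvable_of_cut (S : M → Fin 3) (hx0 : bundleVal x S 0 ≤ α) (hx1 : bundleVal x S 1 ≤ α)
    (hy1 : bundleVal y S 1 ≤ β) (hy2 : bundleVal y S 2 ≤ β) : Solvable z x y α β := by
  obtain ⟨k, hk⟩ := exists_bundleVal_le_PS z S
  fin_cases k
  · exact ⟨S, hk, hx1, hy2⟩
  · refine ⟨fun e => Equiv.swap 0 1 (S e), ?_, ?_, ?_⟩ <;> rw [bundleVal_comp_perm]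
    · simpa using hk
    · simpa using hx0
    · simpa [Equiv.swap_apply_of_ne_of_ne] using hy2
  · refine ⟨fun e => finRotate 3 (S e), ?_, ?_, ?_⟩ <;> rw [bundleVal_comp_perm]
    · exact hk
    · exact hx0
    · exact hy1

/-- Cut and choose with two partitions `S` and `D` sharing the part `0`. -/
lemma solvable_of_split (S D : M → Fin 3) (hSD : ∀ e, D e = 0 ↔ S e = 0)
    (hx : bundleVal x S 1 ≤ α) (hy0 : bundleVal y S 0 ≤ β) (hy2 : bundleVal y S 2 ≤ β)
    (hD1 : bundleVal x D 1 ≤ α) (hD2 : bundleVal x D 2 ≤ α) : Solvable z x y α β := by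
  have h0 : ∀ w : M → ℝ, bundleVal w D 0 = bundleVal w S 0 := fun w => by
    simp only [bundleVal, hSD]
  obtain ⟨k, hk⟩ := exists_bundleVal_le_PS z D
  fin_cases k
  · exact ⟨S, (h0 z).symm.trans_le hk, hx, hy2⟩
  · refine ⟨fun e => (finRotate 3).symm (D e), ?_, ?_, ?_⟩ <;> rw [bundleVal_comp_perm]
    · exact hk
    · exact hD2
    · exact (h0 y).trans_le hy0
  · refine ⟨fun e => Equiv.swap 0 2 (D e), ?_, ?_, ?_⟩ <;> rw [bundleVal_comp_perm]
    · simpa using hk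
    · simpa [Equiv.swap_apply_of_ne_of_ne] using hD1
    · simpa using (h0 y).trans_le hy0

lemma unsplittable_of_not_solvable (hs : ¬ Solvable z x y α β) (f g : M → Fin 3)
    (hy : ∀ k, bundleVal y g k ≤ β) (hx : bundleVal x g 0 ≤ α) {c : Fin 3} (hc : c ≠ 0) :
    Unsplittable α (fun i => cell x f g i 0) (fun i => cell x f g i c) := by
  intro p q
  by_contra! h
  obtain ⟨r, hr0, hrc⟩ := exists_ne_ne_fin_three 0 c
  obtain ⟨σ, hσr, hσ0, hσc⟩ := exists_perm_three r 0 c hr0 hrc hc.symm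
  let T : Fin 3 → Fin 3 → Fin 3 := fun i j =>
    if j = r then 0 else if j = 0 then (if p i then 1 else 2) else (if q i then 1 else 2)
  refine hs (solvable_of_split (fun e => σ.symm (g e)) (fun e => T (f e) (g e))
    (fun e => ?_) ?_ ?_ ?_ ?_ ?_)
  · rw [Equiv.symm_apply_eq, hσr]
    dsimp only [T]
    split_ifs <;> simp [hr0.symm, *]
  · simpa [bundleVal_comp_perm, hσ0] using hx
  · simpa [bundleVal_comp_perm] using hy _
  · simpa [bundleVal_comp_perm] using hy _
  · rw [bundleVal_grid]
    refine le_trans (le_of_eq (Finset.sum_congr rfl fun i _ => ?_)) h.1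
    rw [← Equiv.sum_comp σ, Fin.sum_univ_three, hσr, hσ0, hσc]
    cases hp : p i <;> cases hq : q i <;> simp [T, hr0.symm, hrc.symm, hc, hp, hq]
  · rw [bundleVal_grid]
    refine le_trans (le_of_eq (Finset.sum_congr rfl fun i _ => ?_)) h.2
    rw [← Equiv.sum_comp σ, Fin.sum_univ_three, hσr, hσ0, hσc]
    cases hp : p i <;> cases hq : q i <;> simp [T, hr0.symm, hrc.symm, hc, hp, hq]

lemma exists_shape_of_not_solvable {a b : ℝ} (hs : ¬ Solvable z x y (19 * a) (19 * b))
    (hxpos : ∀ e, 0 ≤ x e) (hypos : ∀ e, 0 ≤ y e) (f g : M → Fin 3)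
    (hf : ∀ k, bundleVal x f k ≤ 18 * a) (hg : ∀ k, bundleVal y g k ≤ 18 * b) :
    ∃ (τ : Equiv.Perm (Fin 3)) (k : Fin 3),
      Shape (cell x f fun e => τ (g e)) (19 * a) k := by
  have ha : 0 ≤ a := by linarith [hf 0, bundleVal_nonneg_s10 hxpos f 0]
  have hb : 0 ≤ b := by linarith [hg 0, bundleVal_nonneg_s10 hypos g 0]
  have hg' : ∀ k, bundleVal y g k ≤ 19 * b := fun k => by linarith [hg k]
  obtain ⟨l, hl⟩ : ∃ l, bundleVal x g l ≤ 19 * a := by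
    by_contra! h
    have hfs := sum_bundleVal x f
    have hgs := sum_bundleVal x g
    rw [Fin.sum_univ_three] at hfs hgs
    linarith [h 0, h 1, h 2, hf 0, hf 1, hf 2]
  have hlight : ∀ c, c ≠ l → 19 * a < bundleVal x g c := by
    intro c hc
    by_contra! h
    obtain ⟨r, hrl, hrc⟩ := exists_ne_ne_fin_three l c
    obtain ⟨σ, hσl, hσc, hσr⟩ := exists_perm_three l c r hc.symm hrl.symm hrc.symm
    refine hs (solvable_of_cut (fun e => σ.symm (g e)) ?_ ?_ ?_ ?_) <;>
      simp [bundleVal_comp_perm, *]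
  have : Nonempty {c // c ≠ l} := ⟨⟨l + 1, by simp⟩⟩
  obtain ⟨⟨k, c, hc⟩, hkc⟩ :=
    Finite.exists_max fun p : Fin 3 × {c // c ≠ l} => cell x f g p.1 p.2
  obtain ⟨m, hml, hmc⟩ := exists_ne_ne_fin_three l c
  obtain ⟨σ, hσl, hσc, hσm⟩ := exists_perm_three l c m hc.symm hml.symm hmc.symm
  have hcell : ∀ i j, cell x f (fun e => σ.symm (g e)) i j = cell x f g i (σ j) := fun i j =>
    cell_comp_perm x f g (Equiv.refl _) σ.symm i j
  have hcol : ∀ j, ∑ i, cell x f (fun e => σ.symm (g e)) i j = bundleVal x g (σ j) := fun j => by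
    rw [sum_cell_col, bundleVal_comp_perm, Equiv.symm_symm]
  have hu : ∀ j, j ≠ 0 → Unsplittable (19 * a) (fun i => cell x f (fun e => σ.symm (g e)) i 0)
      (fun i => cell x f (fun e => σ.symm (g e)) i j) := fun j hj =>
    unsplittable_of_not_solvable hs f _ (fun k => by simpa [bundleVal_comp_perm] using hg' _)
      (by simpa [bundleVal_comp_perm, hσl] using hl) hj
  refine ⟨σ.symm, k, shape_of_unsplittable (cell_nonneg hxpos _ _) (fun i => ?_) ?_ ?_ ?_
    (fun i => ?_) (fun i => ?_) (hu 1 (by decide)) (hu 2 (by decide))⟩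
  · rw [← Fin.sum_univ_three (fun j => cell x f (fun e => σ.symm (g e)) i j), sum_cell_row]
    exact hf i
  · rwa [hcol, hσl]
  · rw [hcol, hσc]
    exact hlight c hc
  · rw [hcol, hσm]
    exact hlight m hml
  · rw [hcell, hcell, hσc]
    exact hkc (i, ⟨c, hc⟩)
  · rw [hcell, hcell, hσc, hσm]
    exact hkc (i, ⟨m, hml⟩)

theorem solvable_of_partitions {a b : ℝ} (hxpos : ∀ e, 0 ≤ x e) (hypos : ∀ e, 0 ≤ y e)
    (f g : M → Fin 3) (hf : ∀ k, bundleVal x f k ≤ 18 * a) (hg : ∀ k, bundleVal y g k ≤ 18 * b) :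
    Solvable z x y (19 * a) (19 * b) := by
  by_contra hs
  obtain ⟨τ, k, hk⟩ := exists_shape_of_not_solvable hs hxpos hypos f g hf hg
  obtain ⟨σ, l, hl⟩ := exists_shape_of_not_solvable (fun h => hs h.symm) hypos hxpos g f hg hf
  have hX : Shape (cell x (fun e => σ (f e)) fun e => τ (g e)) (19 * a) (σ k) := by
    have h : cell x (fun e => σ (f e)) (fun e => τ (g e)) =
        fun i j => cell x f (fun e => τ (g e)) (σ.symm i) j := by
      ext i j
      exact cell_comp_perm x f (fun e => τ (g e)) σ (Equiv.refl _) i j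
    rw [h]
    exact hk.comp_perm σ
  have hY : Shape (fun j i => cell y (fun e => σ (f e)) (fun e => τ (g e)) i j) (19 * b) (τ l) := by
    have h : (fun j i => cell y (fun e => σ (f e)) (fun e => τ (g e)) i j) =
        fun j i => cell y g (fun e => σ (f e)) (τ.symm j) i := by
      ext j i
      rw [cell_swap]
      exact cell_comp_perm y g (fun e => σ (f e)) τ (Equiv.refl _) j i
    rw [h]
    exact hl.comp_perm τ
  obtain ⟨T, h0, h1, h2, h3⟩ :=
    exists_gridLoad_le (cell_nonneg hxpos _ _) (cell_nonneg hypos _ _) hX hY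
  simp only [← bundleVal_grid] at h0 h1 h2 h3
  exact hs (solvable_of_cut _ h0 h1 h2 h3)

lemma exists_bundleVal_le_mmS [DecidableEq M] (w : M → ℝ) :
    ∃ f : M → Fin 3, ∀ k, bundleVal w f k ≤ mmS 3 w := by
  obtain ⟨f, -, hf⟩ := Finset.exists_mem_eq_inf' (Finset.univ_nonempty (α := M → Fin 3))
    fun f => Finset.univ.sup' Finset.univ_nonempty fun j => bundleVal w f j
  refine ⟨f, fun k => ?_⟩
  rw [mmS, hf]
  exact Finset.le_sup' (fun j => bundleVal w f j) (Finset.mem_univ k)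

end Allocations

/-- For three agents with additive nonnegative cost functions over chores
and a prespecified agent u, there is an allocation giving u cost at most her
proportional share and each other agent cost at most 19/18 of her minimax share
(a (19/18)-P⁺mm allocation). -/
theorem exists_P_plus_mm_allocation_chores {M : Type*} [Fintype M] [DecidableEq M]
    (v : Fin 3 → M → ℝ) (hv : ∀ i e, 0 ≤ v i e) (u : Fin 3) :
    ∃ A : M → Fin 3, bundleVal (v u) A u ≤ PS 3 (v u) ∧
      ∀ i, i ≠ u → bundleVal (v i) A i ≤ (19/18 : ℝ) * mmS 3 (v i) := by
  obtain ⟨f, hf⟩ := exists_bundleVal_le_mmS (v (u + 1))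
  obtain ⟨g, hg⟩ := exists_bundleVal_le_mmS (v (u + 2))
  obtain ⟨A, h0, h1, h2⟩ := solvable_of_partitions (z := v u) (a := mmS 3 (v (u + 1)) / 18)
    (b := mmS 3 (v (u + 2)) / 18) (hv (u + 1)) (hv (u + 2)) f g
    (fun k => by linarith [hf k]) (fun k => by linarith [hg k])
  have hA : ∀ (w : M → ℝ) (k : Fin 3),
      bundleVal w (fun e => Equiv.addLeft u (A e)) (u + k) = bundleVal w A k := fun w k => by
    rw [bundleVal_comp_perm]
    simp
  refine ⟨fun e => Equiv.addLeft u (A e), ?_, fun i hi => ?_⟩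
  · rw [← hA, add_zero] at h0
    exact h0
  · have hcases : ∀ u i : Fin 3, i ≠ u → i = u + 1 ∨ i = u + 2 := by decide
    rcases hcases u i hi with rfl | rfl
    · rw [hA]
      linarith
    · rw [hA]
      linarith
end

section
/- There exists an instance with three agents, named R, C and U, having additive nonnegative cost functions over a finite set of chores, such that in every allocation A = (A_R, A_C, A_U), either v^R(A_R) ≥ (19/18)·mmS^R, or v^C(A_C) ≥ (19/18)·mmS^C, or v^U(A_U) ≥ (19/18)·PS^U. Hence the ratio 19/18 is best possible for Pmm allocations of chores to three agents. -/
/-- Costs of eight chores for agents R, C and U. The total cost is 54 for each agent. -/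
def choreCost : Fin 3 → Fin 8 → ℕ :=
  ![![5, 13, 7, 3, 8, 7, 3, 8], ![4, 12, 7, 3, 9, 7, 3, 9], ![3, 13, 8, 3, 8, 8, 3, 8]]

/-- The value of a bundle under natural-number costs, as a cast of a natural-number sum. -/
lemma bundleVal_natCast {M : Type*} [Fintype M] {n : ℕ} (c : M → ℕ) (f : M → Fin n)
    (j : Fin n) :
    bundleVal (fun e => (c e : ℝ)) f j = ((∑ e, if f e = j then c e else 0 : ℕ) : ℝ) := by
  simp [bundleVal, Finset.sum_filter]

/-- Any partition bounds the minimax share from above by its largest bundle. -/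
lemma mmS_le_of_forall_bundleVal_le {M : Type*} [Fintype M] [DecidableEq M] {n : ℕ} [NeZero n]
    {v : M → ℝ} {b : ℝ} (f : M → Fin n) (h : ∀ j, bundleVal v f j ≤ b) : mmS n v ≤ b :=
  (Finset.inf'_le _ (Finset.mem_univ f)).trans (Finset.sup'_le _ _ fun j _ => h j)

lemma mmS_choreCost_zero_le : mmS 3 (fun e => (choreCost 0 e : ℝ)) ≤ 18 := by
  refine mmS_le_of_forall_bundleVal_le ![0, 0, 1, 1, 1, 2, 2, 2] fun j => ?_
  rw [bundleVal_natCast]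
  exact_mod_cast (show _ ≤ 18 by revert j; decide)

lemma mmS_choreCost_one_le : mmS 3 (fun e => (choreCost 1 e : ℝ)) ≤ 18 := by
  refine mmS_le_of_forall_bundleVal_le ![0, 1, 0, 1, 2, 0, 1, 2] fun j => ?_
  rw [bundleVal_natCast]
  exact_mod_cast (show _ ≤ 18 by revert j; decide)

lemma PS_choreCost_two : PS 3 (fun e => (choreCost 2 e : ℝ)) = 18 := by
  have h : ∑ e, choreCost 2 e = 54 := by decide
  rw [PS, ← Nat.cast_sum, h]
  norm_num

/-- Depth-first check that every way to distribute the listed chores, when the three agents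
already bear costs `r`, `c` and `u`, leaves some agent with a cost of at least 19. -/
def alwaysCostly : List (Fin 8) → ℕ → ℕ → ℕ → Bool
  | [], r, c, u => Nat.ble 19 r || Nat.ble 19 c || Nat.ble 19 u
  | e :: l, r, c, u => Nat.ble 19 r || Nat.ble 19 c || Nat.ble 19 u ||
      (alwaysCostly l (r + choreCost 0 e) c u && alwaysCostly l r (c + choreCost 1 e) u &&
        alwaysCostly l r c (u + choreCost 2 e))

lemma nineteen_le_of_alwaysCostly (A : Fin 8 → Fin 3) (l : List (Fin 8)) (r c u : ℕ)
    (h : alwaysCostly l r c u = true) :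
    19 ≤ r + (l.map fun e => if A e = 0 then choreCost 0 e else 0).sum ∨
    19 ≤ c + (l.map fun e => if A e = 1 then choreCost 1 e else 0).sum ∨
    19 ≤ u + (l.map fun e => if A e = 2 then choreCost 2 e else 0).sum := by
  induction l generalizing r c u with
  | nil =>
    simp only [alwaysCostly, Bool.or_eq_true, Nat.ble_eq] at h
    simp only [List.map_nil, List.sum_nil]
    omega
  | cons e l ih =>
    simp only [alwaysCostly, Bool.or_eq_true, Bool.and_eq_true, Nat.ble_eq] at h
    simp only [List.map_cons, List.sum_cons]
    rcases h with h | ⟨⟨hr, hc⟩, hu⟩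
    · omega
    · have hA : A e = 0 ∨ A e = 1 ∨ A e = 2 := by
        generalize A e = a
        revert a
        decide
      rcases hA with hA | hA | hA
      · simpa [hA, add_assoc] using ih _ _ _ hr
      · simpa [hA, add_assoc] using ih _ _ _ hc
      · simpa [hA, add_assoc] using ih _ _ _ hu

/-- In every allocation some agent bears a cost of at least 19. -/
lemma nineteen_le_cost (A : Fin 8 → Fin 3) :
    19 ≤ ∑ e, (if A e = 0 then choreCost 0 e else 0) ∨
    19 ≤ ∑ e, (if A e = 1 then choreCost 1 e else 0) ∨
    19 ≤ ∑ e, (if A e = 2 then choreCost 2 e else 0) := by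
  have hperm : (Finset.univ : Finset (Fin 8)) = [1, 4, 7, 0, 2, 5, 3, 6].toFinset := by decide
  have h := nineteen_le_of_alwaysCostly A [1, 4, 7, 0, 2, 5, 3, 6] 0 0 0 (by decide +kernel)
  simp only [zero_add] at h
  rw [hperm]
  simpa only [List.sum_toFinset _
    (show ([1, 4, 7, 0, 2, 5, 3, 6] : List (Fin 8)).Nodup by decide)] using h

/-- There is an instance with three agents R = 0, C = 1, U = 2 with
additive nonnegative cost functions over chores such that in every allocation, R gets at
least (19/18)·mmS^R, or C gets at least (19/18)·mmS^C, or U gets at least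
(19/18)·PS^U. -/
theorem exists_negative_instance_Pmm_chores :
    ∃ (M : Type) (i1 : Fintype M) (i2 : DecidableEq M) (v : Fin 3 → M → ℝ),
      (∀ i e, 0 ≤ v i e) ∧
      ∀ A : M → Fin 3,
        (19/18 : ℝ) * @mmS M i1 i2 3 _ (v 0) ≤ @bundleVal M i1 3 (v 0) A 0 ∨
        (19/18 : ℝ) * @mmS M i1 i2 3 _ (v 1) ≤ @bundleVal M i1 3 (v 1) A 1 ∨
        (19/18 : ℝ) * @PS M i1 3 (v 2) ≤ @bundleVal M i1 3 (v 2) A 2 := by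
  refine ⟨Fin 8, inferInstance, inferInstance, fun i e => (choreCost i e : ℝ),
    fun _ _ => Nat.cast_nonneg _, fun A => ?_⟩
  simp only [bundleVal_natCast]
  have hR := mmS_choreCost_zero_le
  have hC := mmS_choreCost_one_le
  have hU := PS_choreCost_two
  rcases nineteen_le_cost A with h | h | h
  · have h' := (Nat.cast_le (α := ℝ)).2 h
    push_cast at h' ⊢
    exact Or.inl (by linarith)
  · have h' := (Nat.cast_le (α := ℝ)).2 h
    push_cast at h' ⊢
    exact Or.inr (Or.inl (by linarith))
  · have h' := (Nat.cast_le (α := ℝ)).2 h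
    push_cast at h' ⊢
    exact Or.inr (Or.inr (by linarith))
end
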